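/- arXiv:1703.01066 — 2 statements merged into one kernel-verified Lean document; each statement's English description precedes it below -/
import Mathlib

section
/- Let d ≥ 1, t > 0, σ > 0 and a, x ∈ ℝ^d. Then ∫_{ℝ^d} g(x,t,y)·exp(−|y − a|²/(2σ)) dy = (σ/(σ·cosh(t) + sinh(t)))^{d/2} · exp(−|a|²/(2σ)) · exp(−cosh(t)·|x|²/(2·sinh(t)) + |σ·x + sinh(t)·a|²/(2·σ·sinh(t)·(σ·cosh(t) + sinh(t)))). -/
open Real MeasureTheory

/-- Integral of a Gaussian centred at an arbitrary point. -/
lemma integral_exp_neg_mul_norm_sub_sq {V : Type*} [NormedAddCommGroup V]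
    [InnerProductSpace ℝ V] [FiniteDimensional ℝ V] [MeasurableSpace V] [BorelSpace V]
    {b : ℝ} (hb : 0 < b) (w : V) :
    ∫ v : V, Real.exp (-b * ‖v - w‖ ^ 2) = (π / b) ^ (Module.finrank ℝ V / 2 : ℝ) := by
  rw [integral_sub_right_eq_self (fun v : V => Real.exp (-b * ‖v‖ ^ 2)) w]
  exact GaussianFourier.integral_rexp_neg_mul_sq_norm hb

/-- Completing the square in the product of a Mehler-type and a Gaussian exponent. -/
lemma mehler_exponent_add_gaussian_exponent {V : Type*} [NormedAddCommGroup V]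
    [InnerProductSpace ℝ V] {c s σ : ℝ} (hs : s ≠ 0) (hσ : σ ≠ 0) (hD : σ * c + s ≠ 0)
    (a x y : V) :
    -(c * (‖x‖ ^ 2 + ‖y‖ ^ 2) - 2 * inner ℝ x y) / (2 * s) + -‖y - a‖ ^ 2 / (2 * σ) =
      -((σ * c + s) / (2 * σ * s)) * ‖y - (σ * c + s)⁻¹ • (σ • x + s • a)‖ ^ 2 +
        (-‖a‖ ^ 2 / (2 * σ) + (-(c * ‖x‖ ^ 2) / (2 * s) +
          ‖σ • x + s • a‖ ^ 2 / (2 * σ * s * (σ * c + s)))) := by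
  have h : inner ℝ y (σ • x + s • a) = σ * inner ℝ x y + s * inner ℝ y a := by
    rw [inner_add_right, real_inner_smul_right, real_inner_smul_right, real_inner_comm y x]
  rw [norm_sub_sq_real y a, norm_sub_sq_real y, real_inner_smul_right, norm_smul, mul_pow, h,
    Real.norm_eq_abs, sq_abs]
  obtain ⟨D, hc⟩ : ∃ D, D = σ * c + s := ⟨_, rfl⟩
  obtain rfl : c = (D - s) / σ := by field_simp; linarith
  rw [← hc] at hD ⊢
  field_simp
  ring

theorem stmt_9 (d : ℕ) (hd : 1 ≤ d) (t σ : ℝ) (ht : 0 < t) (hσ : 0 < σ)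
    (a x : EuclideanSpace ℝ (Fin d))
    (g : EuclideanSpace ℝ (Fin d) → ℝ → EuclideanSpace ℝ (Fin d) → ℝ)
    (hg : ∀ x s y, 0 < s → g x s y =
      (2 * Real.pi * Real.sinh s) ^ (-(d : ℝ) / 2) *
        Real.exp (-(Real.cosh s * (‖x‖ ^ 2 + ‖y‖ ^ 2) - 2 * (inner ℝ x y : ℝ)) /
          (2 * Real.sinh s))) :
    (∫ y, g x t y * Real.exp (-‖y - a‖ ^ 2 / (2 * σ))) =
      (σ / (σ * Real.cosh t + Real.sinh t)) ^ ((d : ℝ) / 2) *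
        Real.exp (-‖a‖ ^ 2 / (2 * σ)) *
        Real.exp (-(Real.cosh t * ‖x‖ ^ 2) / (2 * Real.sinh t) +
          ‖σ • x + Real.sinh t • a‖ ^ 2 /
            (2 * σ * Real.sinh t * (σ * Real.cosh t + Real.sinh t))) := by
  have hs : 0 < Real.sinh t := Real.sinh_pos_iff.2 ht
  have hc : 0 < Real.cosh t := Real.cosh_pos t
  have hD : 0 < σ * Real.cosh t + Real.sinh t := by positivity
  have hb : 0 < (σ * Real.cosh t + Real.sinh t) / (2 * σ * Real.sinh t) := by positivity
  simp_rw [hg x t _ ht, mul_assoc, ← Real.exp_add]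
  simp_rw [← mul_assoc,
    mehler_exponent_add_gaussian_exponent hs.ne' hσ.ne' hD.ne' a x, Real.exp_add _ (_ + _)]
  rw [integral_const_mul, integral_mul_const, integral_exp_neg_mul_norm_sub_sq hb,
    finrank_euclideanSpace_fin, ← mul_assoc, neg_div, Real.rpow_neg (by positivity),
    ← Real.inv_rpow (by positivity), ← Real.mul_rpow (by positivity) (by positivity)]
  congr 2
  field_simp
end

section
/- Let d ≥ 1 and T > 0. Then ∫_{ℝ^d × ℝ^d} exp(−|x|²/2)·g(x,T,y)·exp(−|y|²/2) dx dy = π^{d/2}·exp(−dT/2). Consequently the constant 𝒩 = π^{−d/4}·exp(dT/4) satisfies the normalization condition 𝒩²·∫_{ℝ^d × ℝ^d} exp(−|x|²/2)·g(x,T,y)·exp(−|y|²/2) dx dy = 1. -/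
open Real MeasureTheory

/-- The Gaussian integral of a quadratic form on `V × V`, written as a sum of squares. -/
lemma integral_prod_exp_neg_mul_sq_norm_sub_smul {V : Type*} [NormedAddCommGroup V]
    [InnerProductSpace ℝ V] [FiniteDimensional ℝ V] [MeasurableSpace V] [BorelSpace V]
    {p q : ℝ} (hp : 0 < p) (hq : 0 < q) (c : ℝ) :
    ∫ z : V × V, Real.exp (-p * ‖z.1‖ ^ 2) * Real.exp (-q * ‖z.2 - c • z.1‖ ^ 2) =
      (π / p) ^ (Module.finrank ℝ V / 2 : ℝ) * (π / q) ^ (Module.finrank ℝ V / 2 : ℝ) := by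
  have hshear : MeasurePreserving (fun z : V × V ↦ (z.1, z.2 + c • z.1)) volume volume := by
    refine (MeasurePreserving.id volume).skew_product (g := fun x y ↦ y + c • x) ?_ ?_
    · fun_prop
    · exact .of_forall fun x ↦ map_add_right_eq_self volume (c • x)
  rw [← hshear.map_eq, integral_map hshear.measurable.aemeasurable
    (Continuous.aestronglyMeasurable (by fun_prop))]
  simp only [add_sub_cancel_right]
  rw [Measure.volume_eq_prod, integral_prod_mul (fun x : V ↦ Real.exp (-p * ‖x‖ ^ 2))
    (fun y : V ↦ Real.exp (-q * ‖y‖ ^ 2)), GaussianFourier.integral_rexp_neg_mul_sq_norm hp,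
    GaussianFourier.integral_rexp_neg_mul_sq_norm hq]

/-- The Gaussian integral of the quadratic form `a (‖x‖² + ‖y‖²) / 2 - b ⟪x, y⟫` on `V × V`. -/
lemma integral_prod_exp_neg_add_inner {V : Type*} [NormedAddCommGroup V]
    [InnerProductSpace ℝ V] [FiniteDimensional ℝ V] [MeasurableSpace V] [BorelSpace V]
    {a b : ℝ} (ha : 0 < a) (hab : b ^ 2 < a ^ 2) :
    ∫ z : V × V, Real.exp (-(a / 2 * (‖z.1‖ ^ 2 + ‖z.2‖ ^ 2) - b * inner ℝ z.1 z.2)) =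
      ((2 * π) ^ 2 / (a ^ 2 - b ^ 2)) ^ (Module.finrank ℝ V / 2 : ℝ) := by
  have hD : 0 < a ^ 2 - b ^ 2 := sub_pos.2 hab
  have hp : 0 < (a ^ 2 - b ^ 2) / (2 * a) := by positivity
  calc
    _ = ∫ z : V × V, Real.exp (-((a ^ 2 - b ^ 2) / (2 * a)) * ‖z.1‖ ^ 2) *
          Real.exp (-(a / 2) * ‖z.2 - (b / a) • z.1‖ ^ 2) := by
      refine integral_congr_ae (.of_forall fun z ↦ ?_)
      simp only
      rw [← Real.exp_add, norm_sub_sq_real, inner_smul_right, norm_smul, mul_pow,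
        Real.norm_eq_abs, sq_abs, real_inner_comm]
      congr 1
      field_simp
      ring
    _ = _ := by
      rw [integral_prod_exp_neg_mul_sq_norm_sub_smul hp (half_pos ha),
        ← Real.mul_rpow (by positivity) (by positivity)]
      congr 1
      field_simp

theorem stmt_10 (d : ℕ) (hd : 1 ≤ d) (T : ℝ) (hT : 0 < T)
    (g : EuclideanSpace ℝ (Fin d) → ℝ → EuclideanSpace ℝ (Fin d) → ℝ)
    (hg : ∀ x s y, 0 < s → g x s y =
      (2 * Real.pi * Real.sinh s) ^ (-(d : ℝ) / 2) *
        Real.exp (-(Real.cosh s * (‖x‖ ^ 2 + ‖y‖ ^ 2) - 2 * (inner ℝ x y : ℝ)) /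
          (2 * Real.sinh s))) :
    (∫ p : EuclideanSpace ℝ (Fin d) × EuclideanSpace ℝ (Fin d),
        Real.exp (-‖p.1‖ ^ 2 / 2) * g p.1 T p.2 * Real.exp (-‖p.2‖ ^ 2 / 2)) =
      Real.pi ^ ((d : ℝ) / 2) * Real.exp (-(d : ℝ) * T / 2) ∧
    (Real.pi ^ (-(d : ℝ) / 4) * Real.exp ((d : ℝ) * T / 4)) ^ 2 *
      (∫ p : EuclideanSpace ℝ (Fin d) × EuclideanSpace ℝ (Fin d),
        Real.exp (-‖p.1‖ ^ 2 / 2) * g p.1 T p.2 * Real.exp (-‖p.2‖ ^ 2 / 2)) = 1 := by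
  have hs : 0 < Real.sinh T := Real.sinh_pos_iff.2 hT
  have hdet : (Real.exp T / Real.sinh T) ^ 2 - (1 / Real.sinh T) ^ 2 =
      2 * Real.exp T / Real.sinh T := by
    have hsq := Real.cosh_sq T
    rw [← Real.cosh_add_sinh]
    field_simp
    linear_combination hsq
  have hlt : (1 / Real.sinh T) ^ 2 < (Real.exp T / Real.sinh T) ^ 2 := by
    rw [← sub_pos, hdet]
    positivity
  have hint : (∫ p : EuclideanSpace ℝ (Fin d) × EuclideanSpace ℝ (Fin d),
      Real.exp (-‖p.1‖ ^ 2 / 2) * g p.1 T p.2 * Real.exp (-‖p.2‖ ^ 2 / 2)) =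
      Real.pi ^ ((d : ℝ) / 2) * Real.exp (-(d : ℝ) * T / 2) := by
    calc
      _ = ∫ p : EuclideanSpace ℝ (Fin d) × EuclideanSpace ℝ (Fin d),
            (2 * π * Real.sinh T) ^ (-(d : ℝ) / 2) *
            Real.exp (-(Real.exp T / Real.sinh T / 2 * (‖p.1‖ ^ 2 + ‖p.2‖ ^ 2) -
              1 / Real.sinh T * inner ℝ p.1 p.2)) := by
        refine integral_congr_ae (.of_forall fun p ↦ ?_)
        simp only
        rw [hg _ _ _ hT, mul_left_comm, mul_assoc, ← Real.exp_add, ← Real.exp_add]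
        congr 2
        rw [← Real.cosh_add_sinh]
        field_simp
        ring
      _ = _ := by
        rw [integral_const_mul, integral_prod_exp_neg_add_inner (by positivity) hlt, hdet,
          finrank_euclideanSpace_fin, neg_div, Real.rpow_neg (by positivity),
          ← Real.inv_rpow (by positivity), ← Real.mul_rpow (by positivity) (by positivity),
          show -(d : ℝ) * T / 2 = -T * (d / 2) by ring, Real.exp_mul,
          ← Real.mul_rpow (by positivity) (by positivity), Real.exp_neg]
        congr 1
        field_simp
  refine ⟨hint, ?_⟩
  rw [hint, mul_pow, ← Real.rpow_mul_natCast pi_pos.le, ← Real.exp_nat_mul, mul_mul_mul_comm,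
    ← Real.rpow_add pi_pos, ← Real.exp_add]
  norm_num
  ring_nf
  simp
end
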